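/- If T is a subcubic tree with dissociation number ψ, then the number of maximum dissociation sets of T is at most 1.466^(ψ+2). -/

import Mathlib

/-- `F` is a dissociation set of `G`: the induced subgraph `G[F]` has maximum degree at most 1. -/
def IsDissocSet {V : Type*} (G : SimpleGraph V) (F : Finset V) : Prop :=
  ∀ v ∈ F, ∀ u ∈ F, ∀ w ∈ F, G.Adj v u → G.Adj v w → u = w

/-- The dissociation number of `G`. -/
noncomputable def dissocNum {V : Type*} [Fintype V] (G : SimpleGraph V) : ℕ :=
  sSup {n | ∃ F : Finset V, IsDissocSet G F ∧ F.card = n}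

/-- `F` is a maximum dissociation set of `G`. -/
def IsMaxDissocSet {V : Type*} [Fintype V] (G : SimpleGraph V) (F : Finset V) : Prop :=
  IsDissocSet G F ∧ F.card = dissocNum G

/-- The number of maximum dissociation sets of `G`. -/
noncomputable def numMaxDissoc {V : Type*} [Fintype V] (G : SimpleGraph V) : ℕ :=
  {F : Finset V | IsMaxDissocSet G F}.ncard

/-- `G` is subcubic: every vertex has degree at most 3. -/
def Subcubic {V : Type*} (G : SimpleGraph V) : Prop :=
  ∀ v : V, (G.neighborSet v).ncard ≤ 3

/-- all dissociation sets inside `W` -/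
noncomputable def famA {V : Type*} (G : SimpleGraph V) (W : Finset V) : Finset (Finset V) := by
  classical exact W.powerset.filter (IsDissocSet G)

noncomputable def famO {V : Type*} (G : SimpleGraph V) (W R : Finset V) : Finset (Finset V) := by
  classical exact (famA G W).filter (fun F => ∀ c ∈ R, c ∉ F)

noncomputable def famS {V : Type*} (G : SimpleGraph V) (W R : Finset V) : Finset (Finset V) := by
  classical exact (famA G W).filter (fun F => ∃ c ∈ R, c ∈ F ∧ ∀ x ∈ F, ¬ G.Adj c x)

noncomputable def famJ {V : Type*} (Q : Finset V) (A B : Finset (Finset V)) :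
    Finset (Finset V) := by
  classical exact (A ×ˢ B).image (fun p => Q ∪ (p.1 ∪ p.2))

/-- `A` has sets of size at most `p`, and `x * 1.466 ^ m` sets of size `p`. -/
def TopCnt {V : Type*} (A : Finset (Finset V)) (p m : ℤ) (x : ℝ) : Prop :=
  (∀ F ∈ A, (F.card : ℤ) ≤ p) ∧
    ((A.filter (fun F => (F.card : ℤ) = p)).card : ℝ) = x * (1.466 : ℝ) ^ m

lemma mem_famA {V : Type*} {G : SimpleGraph V} {W F : Finset V} :
    F ∈ famA G W ↔ F ⊆ W ∧ IsDissocSet G F := by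
  simp [famA]

lemma mem_famO {V : Type*} {G : SimpleGraph V} {W R F : Finset V} :
    F ∈ famO G W R ↔ (F ⊆ W ∧ IsDissocSet G F) ∧ ∀ c ∈ R, c ∉ F := by
  simp [famO, mem_famA]

lemma mem_famS {V : Type*} {G : SimpleGraph V} {W R F : Finset V} :
    F ∈ famS G W R ↔ (F ⊆ W ∧ IsDissocSet G F) ∧ ∃ c ∈ R, c ∈ F ∧ ∀ x ∈ F, ¬ G.Adj c x := by
  simp [famS, mem_famA]

lemma mem_famJ {V : Type*} [DecidableEq V] {Q W1 W2 : Finset V} {A B : Finset (Finset V)}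
    (h1 : ∀ F ∈ A, F ⊆ W1) (h2 : ∀ F ∈ B, F ⊆ W2) (d : Disjoint W1 W2) (q1 : Disjoint Q W1)
    (q2 : Disjoint Q W2) {F : Finset V} :
    F ∈ famJ Q A B ↔ Q ⊆ F ∧ F ⊆ Q ∪ (W1 ∪ W2) ∧ F ∩ W1 ∈ A ∧ F ∩ W2 ∈ B := by
  have hJ : F ∈ famJ Q A B ↔ ∃ a b, (a ∈ A ∧ b ∈ B) ∧ Q ∪ (a ∪ b) = F := by
    simp only [famJ, Finset.mem_image, Finset.mem_product, Prod.exists]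
    constructor <;> rintro ⟨a, b, h, e⟩ <;> refine ⟨a, b, h, ?_⟩ <;> rw [← e] <;> ext <;> simp
  rw [hJ]
  rw [Finset.disjoint_left] at d q1 q2
  constructor
  · rintro ⟨a, b, ⟨ha, hb⟩, rfl⟩
    have ha' := h1 a ha
    have hb' := h2 b hb
    have e1 : (Q ∪ (a ∪ b)) ∩ W1 = a := by
      ext x
      have := @ha' x; have := @hb' x; have := @d x; have := @q1 x
      simp only [Finset.mem_inter, Finset.mem_union]; tauto
    have e2 : (Q ∪ (a ∪ b)) ∩ W2 = b := by
      ext x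
      have := @ha' x; have := @hb' x; have := @d x; have := @q2 x
      simp only [Finset.mem_inter, Finset.mem_union]; tauto
    refine ⟨Finset.subset_union_left, ?_, by rw [e1]; exact ha, by rw [e2]; exact hb⟩
    exact Finset.union_subset_union le_rfl (Finset.union_subset_union ha' hb')
  · rintro ⟨hq, hF, ha, hb⟩
    refine ⟨_, _, ⟨ha, hb⟩, ?_⟩
    ext x
    have := @hq x; have := @hF x
    simp only [Finset.mem_inter, Finset.mem_union] at *; tauto

lemma TopCnt_famJ {V : Type*} {Q W1 W2 : Finset V} {A B : Finset (Finset V)}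
    (h1 : ∀ F ∈ A, F ⊆ W1) (h2 : ∀ F ∈ B, F ⊆ W2) (d : Disjoint W1 W2) (q1 : Disjoint Q W1)
    (q2 : Disjoint Q W2) {p q m k : ℤ} {x y : ℝ} (hA : TopCnt A p m x) (hB : TopCnt B q k y) :
    TopCnt (famJ Q A B) (p + q + Q.card) (m + k) (x * y) := by
  classical
  have hc : ∀ a ∈ A, ∀ b ∈ B, (Q ∪ (a ∪ b)).card = Q.card + (a.card + b.card) := by
    intro a ha b hb
    have dab : Disjoint a b := d.mono (h1 a ha) (h2 b hb)
    rw [Finset.card_union_of_disjoint, Finset.card_union_of_disjoint dab]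
    exact Finset.disjoint_union_right.2 ⟨q1.mono_right (h1 a ha), q2.mono_right (h2 b hb)⟩
  have hinj : ∀ a ∈ A, ∀ b ∈ B, (Q ∪ (a ∪ b)) ∩ W1 = a ∧ (Q ∪ (a ∪ b)) ∩ W2 = b := by
    intro a ha b hb
    have ha' := h1 a ha
    have hb' := h2 b hb
    rw [Finset.disjoint_left] at d q1 q2
    constructor <;> ext x <;> have := @ha' x <;> have := @hb' x <;> have := @d x <;>
      have := @q1 x <;> have := @q2 x <;> simp only [Finset.mem_inter, Finset.mem_union] <;> tauto
  have hJ : famJ Q A B = (A ×ˢ B).image (fun p => Q ∪ (p.1 ∪ p.2)) := by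
    unfold famJ; congr
  constructor
  · intro F hF
    rw [hJ, Finset.mem_image] at hF
    obtain ⟨⟨a, b⟩, hab, rfl⟩ := hF
    rw [Finset.mem_product] at hab
    have := hA.1 a hab.1
    have := hB.1 b hab.2
    have := hc a hab.1 b hab.2
    simp only at *
    omega
  · have : (famJ Q A B).filter (fun F => (F.card : ℤ) = p + q + Q.card) =
        ((A.filter (fun F => (F.card : ℤ) = p)) ×ˢ (B.filter (fun F => (F.card : ℤ) = q))).image
          (fun p => Q ∪ (p.1 ∪ p.2)) := by
      rw [hJ]
      ext F
      simp only [Finset.mem_filter, Finset.mem_image, Finset.mem_product, Prod.exists]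
      constructor
      · rintro ⟨⟨a, b, ⟨ha, hb⟩, rfl⟩, hcard⟩
        have := hA.1 a ha
        have := hB.1 b hb
        have := hc a ha b hb
        exact ⟨a, b, ⟨⟨ha, by omega⟩, ⟨hb, by omega⟩⟩, rfl⟩
      · rintro ⟨a, b, ⟨⟨ha, ea⟩, ⟨hb, eb⟩⟩, rfl⟩
        have := hc a ha b hb
        exact ⟨⟨a, b, ⟨ha, hb⟩, rfl⟩, by omega⟩
    rw [this, Finset.card_image_of_injOn, Finset.card_product]
    · push_cast
      rw [hA.2, hB.2, zpow_add₀ (by norm_num)]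
      ring
    · rintro ⟨a, b⟩ hab ⟨a', b'⟩ hab' he
      simp only [Finset.coe_product, Set.mem_prod, Finset.mem_coe, Finset.mem_filter] at hab hab' he
      have e1 := hinj a hab.1.1 b hab.2.1
      have e2 := hinj a' hab'.1.1 b' hab'.2.1
      rw [he] at e1
      rw [← e1.1, ← e1.2, e2.1, e2.2]

lemma TopCnt.union {V : Type*} [DecidableEq V] {A B : Finset (Finset V)} {p m : ℤ} {x y : ℝ}
    (hA : TopCnt A p m x) (hB : TopCnt B p m y) (h : Disjoint A B) : TopCnt (A ∪ B) p m (x + y) := by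
  constructor
  · intro F hF
    rcases Finset.mem_union.1 hF with h | h
    · exact hA.1 F h
    · exact hB.1 F h
  · rw [Finset.filter_union, Finset.card_union_of_disjoint
      (Finset.disjoint_filter_filter h)]
    push_cast
    rw [hA.2, hB.2]; ring

lemma TopCnt.up {V : Type*} {A : Finset (Finset V)} {p m : ℤ} {x : ℝ}
    (hA : TopCnt A p m x) (q : ℤ) (h : p ≤ q) : TopCnt A q m (if p = q then x else 0) := by
  split_ifs with e
  · subst e; exact hA
  · refine ⟨fun F hF => (hA.1 F hF).trans h, ?_⟩
    rw [Finset.filter_eq_empty_iff.2]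
    · simp
    · intro F hF
      have := hA.1 F hF
      omega

lemma TopCnt.rescale {V : Type*} {A : Finset (Finset V)} {p m : ℤ} {x : ℝ}
    (hA : TopCnt A p m x) (d : ℤ) : TopCnt A p (m + d) (x / (1.466 : ℝ) ^ d) := by
  refine ⟨hA.1, ?_⟩
  rw [hA.2, zpow_add₀ (by norm_num)]
  have : (1.466 : ℝ) ^ d ≠ 0 := by positivity
  field_simp

structure NodeHyp {V : Type*} (G : SimpleGraph V) (r : V) (W1 R1 W2 R2 : Finset V) : Prop where
  r1 : r ∉ W1
  r2 : r ∉ W2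
  d : Disjoint W1 W2
  s1 : R1 ⊆ W1
  s2 : R2 ⊆ W2
  u1 : ∀ x ∈ R1, ∀ y ∈ R1, x = y
  u2 : ∀ x ∈ R2, ∀ y ∈ R2, x = y
  e : ∀ x ∈ W1, ∀ y ∈ W2, ¬ G.Adj x y
  a1 : ∀ x ∈ W1, (G.Adj r x ↔ x ∈ R1)
  a2 : ∀ x ∈ W2, (G.Adj r x ↔ x ∈ R2)

lemma IsDissocSet.mono {V : Type*} {G : SimpleGraph V} {F F' : Finset V} (h : IsDissocSet G F)
    (hs : F' ⊆ F) : IsDissocSet G F' :=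
  fun v hv u hu w hw => h v (hs hv) u (hs hu) w (hs hw)

lemma NodeHyp.symm {V : Type*} {G : SimpleGraph V} {r : V} {W1 R1 W2 R2 : Finset V}
    (h : NodeHyp G r W1 R1 W2 R2) : NodeHyp G r W2 R2 W1 R1 :=
  ⟨h.r2, h.r1, h.d.symm, h.s2, h.s1, h.u2, h.u1, fun x hx y hy he => h.e y hy x hx he.symm,
    h.a2, h.a1⟩

/-- without the root -/
lemma NodeHyp.dissoc_out {V : Type*} [DecidableEq V] {G : SimpleGraph V} {r : V}
    {W1 R1 W2 R2 : Finset V} (h : NodeHyp G r W1 R1 W2 R2) {F : Finset V} (hF : F ⊆ W1 ∪ W2) :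
    IsDissocSet G F ↔ IsDissocSet G (F ∩ W1) ∧ IsDissocSet G (F ∩ W2) := by
  constructor
  · intro hd
    exact ⟨hd.mono Finset.inter_subset_left, hd.mono Finset.inter_subset_left⟩
  · rintro ⟨h1, h2⟩ v hv u hu w hw e1 e2
    have hv' := Finset.mem_union.1 (hF hv)
    have hu' := Finset.mem_union.1 (hF hu)
    have hw' := Finset.mem_union.1 (hF hw)
    have k1 := h1 v; have k2 := h2 v
    simp only [Finset.mem_inter] at k1 k2
    rcases hv' with hv' | hv'
    · have a : u ∈ W1 := hu'.resolve_right (fun q => h.e v hv' u q e1)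
      have b : w ∈ W1 := hw'.resolve_right (fun q => h.e v hv' w q e2)
      exact k1 ⟨hv, hv'⟩ u ⟨hu, a⟩ w ⟨hw, b⟩ e1 e2
    · have a : u ∈ W2 := hu'.resolve_left (fun q => h.e u q v hv' e1.symm)
      have b : w ∈ W2 := hw'.resolve_left (fun q => h.e w q v hv' e2.symm)
      exact k2 ⟨hv, hv'⟩ u ⟨hu, a⟩ w ⟨hw, b⟩ e1 e2

lemma NodeHyp.famO_eq {V : Type*} [DecidableEq V] {G : SimpleGraph V} {r : V}
    {W1 R1 W2 R2 : Finset V} (h : NodeHyp G r W1 R1 W2 R2) :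
    famO G (insert r (W1 ∪ W2)) {r} = famJ ∅ (famA G W1) (famA G W2) := by
  ext F
  rw [mem_famJ (fun F hF => (mem_famA.1 hF).1) (fun F hF => (mem_famA.1 hF).1) h.d (by simp)
    (by simp), mem_famO, mem_famA, mem_famA]
  simp only [Finset.mem_singleton, forall_eq, Finset.empty_subset, Finset.empty_union, true_and,
    Finset.inter_subset_right]
  constructor
  · rintro ⟨⟨h1, h2⟩, h3⟩
    have : F ⊆ W1 ∪ W2 := (Finset.subset_insert_iff_of_notMem h3).1 h1
    exact ⟨this, (h.dissoc_out this).1 h2⟩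
  · rintro ⟨h1, h2⟩
    refine ⟨⟨h1.trans (Finset.subset_insert _ _), (h.dissoc_out h1).2 h2⟩, fun q => ?_⟩
    have := h1 q
    simp [h.r1, h.r2] at this

/-- If the root is in, the second branch avoids its root, the first branch is fine. -/
lemma NodeHyp.dissoc_in {V : Type*} [DecidableEq V] {G : SimpleGraph V} {r : V}
    {W1 R1 W2 R2 : Finset V} (h : NodeHyp G r W1 R1 W2 R2) {F : Finset V}
    (hF : F ⊆ insert r (W1 ∪ W2)) 
    (h1 : IsDissocSet G (F ∩ W1)) (h2 : IsDissocSet G (F ∩ W2)) (hc2 : ∀ c ∈ R2, c ∉ F)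
    (hc1 : ∀ c ∈ R1, c ∈ F → ∀ x ∈ F ∩ W1, ¬ G.Adj c x) : IsDissocSet G F := by
  intro v hv u hu w hw e1 e2
  have hr : ∀ x ∈ F, G.Adj r x → x ∈ R1 := by
    intro x hx hadj
    have := hF hx
    simp only [Finset.mem_insert, Finset.mem_union] at this
    rcases this with rfl | q | q
    · exact absurd hadj (G.loopless.irrefl _)
    · exact (h.a1 x q).1 hadj
    · exact absurd hx (hc2 x ((h.a2 x q).1 hadj))
  by_cases hvr : v = r
  · subst hvr
    exact h.u1 u (hr u hu e1) w (hr w hw e2)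
  by_cases hur : u = r
  · subst hur
    have hv1 := hr v hv e1.symm
    by_contra hne
    have hw' := hF hw
    simp only [Finset.mem_insert, Finset.mem_union] at hw'
    rcases hw' with q | q | q
    · exact hne q.symm
    · exact hc1 v hv1 hv w (by simp [hw, q]) e2
    · exact h.e v (h.s1 hv1) w q e2
  by_cases hwr : w = r
  · subst hwr
    have hv1 := hr v hv e2.symm
    by_contra hne
    have hu' := hF hu
    simp only [Finset.mem_insert, Finset.mem_union] at hu'
    rcases hu' with q | q | q
    · exact hne q
    · exact hc1 v hv1 hv u (by simp [hu, q]) e1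
    · exact h.e v (h.s1 hv1) u q e1
  · have hsub : F.erase r ⊆ W1 ∪ W2 := by
      intro x hx
      have := hF (Finset.mem_of_mem_erase hx)
      exact (Finset.mem_insert.1 this).resolve_left (Finset.ne_of_mem_erase hx)
    have := (h.dissoc_out hsub).2 ⟨h1.mono (Finset.inter_subset_inter_right (Finset.erase_subset _ _)),
      h2.mono (Finset.inter_subset_inter_right (Finset.erase_subset _ _))⟩
    exact this v (by simp [*]) u (by simp [*]) w (by simp [*]) e1 e2

lemma NodeHyp.famS_eq {V : Type*} [DecidableEq V] {G : SimpleGraph V} {r : V}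
    {W1 R1 W2 R2 : Finset V} (h : NodeHyp G r W1 R1 W2 R2) :
    famS G (insert r (W1 ∪ W2)) {r} = famJ {r} (famO G W1 R1) (famO G W2 R2) := by
  ext F
  rw [mem_famJ (fun F hF => (mem_famO.1 hF).1.1) (fun F hF => (mem_famO.1 hF).1.1) h.d
    (by simp [h.r1]) (by simp [h.r2]), mem_famS, mem_famO, mem_famO]
  simp only [Finset.mem_singleton, exists_eq_left, Finset.singleton_subset_iff,
    Finset.inter_subset_right, true_and, ← Finset.insert_eq]
  constructor
  · rintro ⟨⟨h1, h2⟩, h3, h4⟩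
    refine ⟨h3, h1, ⟨h2.mono Finset.inter_subset_left, ?_⟩, h2.mono Finset.inter_subset_left, ?_⟩
    · intro c hc q
      exact h4 c (Finset.mem_inter.1 q).1 ((h.a1 c (h.s1 hc)).2 hc)
    · intro c hc q
      exact h4 c (Finset.mem_inter.1 q).1 ((h.a2 c (h.s2 hc)).2 hc)
  · rintro ⟨h3, h1, ⟨h4, h5⟩, h6, h7⟩
    have k1 : ∀ c ∈ R1, c ∉ F := fun c hc q => h5 c hc (Finset.mem_inter.2 ⟨q, h.s1 hc⟩)
    have k2 : ∀ c ∈ R2, c ∉ F := fun c hc q => h7 c hc (Finset.mem_inter.2 ⟨q, h.s2 hc⟩)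
    refine ⟨⟨h1, h.dissoc_in h1 h4 h6 k2 fun c hc q => absurd q (k1 c hc)⟩, h3, ?_⟩
    intro x hx hadj
    have := h1 hx
    simp only [Finset.mem_insert, Finset.mem_union] at this
    rcases this with rfl | q | q
    · exact absurd hadj (G.loopless.irrefl _)
    · exact k1 x ((h.a1 x q).1 hadj) hx
    · exact k2 x ((h.a2 x q).1 hadj) hx

lemma NodeHyp.mem_D {V : Type*} [DecidableEq V] {G : SimpleGraph V} {r : V}
    {W1 R1 W2 R2 : Finset V} (h : NodeHyp G r W1 R1 W2 R2) {F : Finset V} :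
    F ∈ famJ {r} (famS G W1 R1) (famO G W2 R2) ↔
      F ∈ famA G (insert r (W1 ∪ W2)) ∧ r ∈ F ∧ ∃ c ∈ R1, c ∈ F := by
  rw [mem_famJ (fun F hF => (mem_famS.1 hF).1.1) (fun F hF => (mem_famO.1 hF).1.1) h.d
    (by simp [h.r1]) (by simp [h.r2]), mem_famA, mem_famS, mem_famO]
  simp only [Finset.singleton_subset_iff,
    Finset.inter_subset_right, true_and, ← Finset.insert_eq]
  constructor
  · rintro ⟨h3, h1, ⟨h4, c, hc, hcF, hcx⟩, h6, h7⟩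
    have k2 : ∀ c ∈ R2, c ∉ F := fun c hc q => h7 c hc (Finset.mem_inter.2 ⟨q, h.s2 hc⟩)
    refine ⟨⟨h1, h.dissoc_in h1 h4 h6 k2 fun c' hc' q => ?_⟩, h3, c, hc, (Finset.mem_inter.1 hcF).1⟩
    rw [h.u1 c' hc' c hc]
    exact hcx
  · rintro ⟨⟨h1, h2⟩, h3, c, hc, hcF⟩
    have hrc := (h.a1 c (h.s1 hc)).2 hc
    refine ⟨h3, h1, ⟨h2.mono Finset.inter_subset_left, c, hc, Finset.mem_inter.2 ⟨hcF, h.s1 hc⟩, ?_⟩,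
      h2.mono Finset.inter_subset_left, ?_⟩
    · intro x hx hadj
      have hx' := Finset.mem_inter.1 hx
      have := h2 c hcF r h3 x hx'.1 hrc.symm hadj
      exact h.r1 (this ▸ hx'.2)
    · intro c' hc' q
      have q' := Finset.mem_inter.1 q
      have := h2 r h3 c hcF c' q'.1 hrc ((h.a2 c' (h.s2 hc')).2 hc')
      exact Finset.disjoint_left.1 h.d (h.s1 hc) (this ▸ q'.2)

lemma famJ_comm {V : Type*} (Q : Finset V) (A B : Finset (Finset V)) :
    famJ Q A B = famJ Q B A := by
  classical
  ext F
  simp only [famJ, Finset.mem_image, Finset.mem_product, Prod.exists]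
  constructor <;> rintro ⟨a, b, h, e⟩ <;> exact ⟨b, a, h.symm, by rw [← e, Finset.union_comm a b]⟩

lemma NodeHyp.mem_D2 {V : Type*} [DecidableEq V] {G : SimpleGraph V} {r : V}
    {W1 R1 W2 R2 : Finset V} (h : NodeHyp G r W1 R1 W2 R2) {F : Finset V} :
    F ∈ famJ {r} (famO G W1 R1) (famS G W2 R2) ↔
      F ∈ famA G (insert r (W1 ∪ W2)) ∧ r ∈ F ∧ ∃ c ∈ R2, c ∈ F := by
  rw [famJ_comm, h.symm.mem_D, Finset.union_comm W2 W1]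

lemma NodeHyp.famA_eq {V : Type*} [DecidableEq V] {G : SimpleGraph V} {r : V}
    {W1 R1 W2 R2 : Finset V} (h : NodeHyp G r W1 R1 W2 R2) :
    famA G (insert r (W1 ∪ W2)) =
      ((famO G (insert r (W1 ∪ W2)) {r} ∪ famS G (insert r (W1 ∪ W2)) {r}) ∪
        famJ {r} (famS G W1 R1) (famO G W2 R2)) ∪ famJ {r} (famO G W1 R1) (famS G W2 R2) := by
  ext F
  simp only [Finset.mem_union, h.mem_D, h.mem_D2, mem_famO, mem_famS, mem_famA,
    Finset.mem_singleton, forall_eq, exists_eq_left]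
  constructor
  · intro hh
    by_cases hr : r ∈ F
    · by_cases hx : ∀ x ∈ F, ¬ G.Adj r x
      · tauto
      · push Not at hx
        obtain ⟨x, hx, hadj⟩ := hx
        have := hh.1 hx
        simp only [Finset.mem_insert, Finset.mem_union] at this
        rcases this with rfl | q | q
        · exact absurd hadj (G.loopless.irrefl _)
        · exact Or.inl (Or.inr ⟨hh, hr, x, (h.a1 x q).1 hadj, hx⟩)
        · exact Or.inr ⟨hh, hr, x, (h.a2 x q).1 hadj, hx⟩
    · tauto
  · tauto

def St {V : Type*} (G : SimpleGraph V) (W R : Finset V) (a b : ℤ) (F o s : ℝ) : Prop :=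
  ∃ p : ℤ, TopCnt (famA G W) p p F ∧ TopCnt (famO G W R) (p - a) p o ∧
    TopCnt (famS G W R) (p - b) p s

lemma NodeHyp.combine {V : Type*} [DecidableEq V] {G : SimpleGraph V} {r : V}
    {W1 R1 W2 R2 : Finset V} (h : NodeHyp G r W1 R1 W2 R2) {a1 b1 a2 b2 : ℤ}
    {F1 o1 s1 F2 o2 s2 : ℝ} (h1 : St G W1 R1 a1 b1 F1 o1 s1) (h2 : St G W2 R2 a2 b2 F2 o2 s2)
    (t : ℤ) (t0 : 0 ≤ t) (t1 : 1 - a1 - a2 ≤ t) (t2 : 1 - b1 - a2 ≤ t) (t3 : 1 - a1 - b2 ≤ t) :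
    St G (insert r (W1 ∪ W2)) {r} t (t - 1 + a1 + a2)
      (((((if 0 = t then F1 * F2 else 0) + (if 1 - a1 - a2 = t then o1 * o2 else 0)) +
        (if 1 - b1 - a2 = t then s1 * o2 else 0)) + (if 1 - a1 - b2 = t then o1 * s2 else 0)) /
          (1.466 : ℝ) ^ t)
      (F1 * F2 / (1.466 : ℝ) ^ t) (o1 * o2 / (1.466 : ℝ) ^ t) := by
  obtain ⟨p, hF1, ho1, hs1⟩ := h1
  obtain ⟨q, hF2, ho2, hs2⟩ := h2
  have wA : ∀ W : Finset V, ∀ F ∈ famA G W, F ⊆ W := fun W F hF => (mem_famA.1 hF).1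
  have wO : ∀ W R : Finset V, ∀ F ∈ famO G W R, F ⊆ W := fun W R F hF => (mem_famO.1 hF).1.1
  have wS : ∀ W R : Finset V, ∀ F ∈ famS G W R, F ⊆ W := fun W R F hF => (mem_famS.1 hF).1.1
  have q1 : Disjoint {r} W1 := by simp [h.r1]
  have q2 : Disjoint {r} W2 := by simp [h.r2]
  have kO := TopCnt_famJ (Q := ∅) (wA W1) (wA W2) h.d (by simp) (by simp) hF1 hF2
  have kS := TopCnt_famJ (wO W1 R1) (wO W2 R2) h.d q1 q2 ho1 ho2
  have kD := TopCnt_famJ (wS W1 R1) (wO W2 R2) h.d q1 q2 hs1 ho2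
  have kE := TopCnt_famJ (wO W1 R1) (wS W2 R2) h.d q1 q2 ho1 hs2
  rw [← h.famO_eq] at kO
  rw [← h.famS_eq] at kS
  simp only [Finset.card_empty, Finset.card_singleton, Nat.cast_zero, Nat.cast_one] at kO kS kD kE
  refine ⟨p + q + t, ?_, ?_, ?_⟩
  · have e := (((kO.up (p + q + t) (by omega)).union (kS.up (p + q + t) (by omega)) ?_).union
      (kD.up (p + q + t) (by omega)) ?_).union (kE.up (p + q + t) (by omega)) ?_
    · rw [← h.famA_eq] at e
      have i0 : (p + q + 0 = p + q + t) = (0 = t) := propext (by constructor <;> intro <;> omega)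
      have i1 : (p - a1 + (q - a2) + 1 = p + q + t) = (1 - a1 - a2 = t) :=
        propext (by constructor <;> intro <;> omega)
      have i2 : (p - b1 + (q - a2) + 1 = p + q + t) = (1 - b1 - a2 = t) :=
        propext (by constructor <;> intro <;> omega)
      have i3 : (p - a1 + (q - b2) + 1 = p + q + t) = (1 - a1 - b2 = t) :=
        propext (by constructor <;> intro <;> omega)
      simp only [i0, i1, i2, i3] at e
      exact e.rescale t
    · rw [Finset.disjoint_left]
      intro F
      simp only [mem_famO, mem_famS, Finset.mem_singleton, forall_eq, exists_eq_left]
      tauto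
    · rw [Finset.disjoint_left]
      intro F
      simp only [h.mem_D, Finset.mem_union, mem_famO, mem_famS, Finset.mem_singleton, forall_eq,
        exists_eq_left]
      rintro (hh | hh)
      · tauto
      · rintro ⟨-, -, c, hc, hcF⟩
        exact hh.2.2 c hcF ((h.a1 c (h.s1 hc)).2 hc)
    · rw [Finset.disjoint_left]
      intro F
      simp only [h.mem_D, h.mem_D2, Finset.mem_union, mem_famO, mem_famS, Finset.mem_singleton,
        forall_eq, exists_eq_left]
      rintro ((hh | hh) | hh)
      · tauto
      · rintro ⟨-, -, c, hc, hcF⟩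
        exact hh.2.2 c hcF ((h.a2 c (h.s2 hc)).2 hc)
      · rintro ⟨-, -, c, hc, hcF⟩
        obtain ⟨hA, hr, c', hc', hcF'⟩ := hh
        have := (mem_famA.1 hA).2 r hr c' hcF' c hcF ((h.a1 c' (h.s1 hc')).2 hc')
          ((h.a2 c (h.s2 hc)).2 hc)
        exact Finset.disjoint_left.1 h.d (h.s1 hc') (this ▸ h.s2 hc)
  · have := kO.rescale t
    convert this using 1; ring
  · have := kS.rescale t
    convert this using 1; ring

structure TA (F o s : ℝ) : Prop where
  f : 0 < F
  p : 0 < o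
  q : 0 < s
  h0 : 0 ≤ 1.1177 - F - 0.507 * o
  h1 : 0 ≤ 0.6822 - F
  h2 : 0 ≤ 1.3296 - o
  h3 : 0 ≤ 1.395 - F - 0.674 * o - 0.371 * s
  h4 : 0 ≤ 1.2443 - 0.824 * o - s
  h5 : 0 ≤ 0.6822 - s

structure TB (F o s : ℝ) : Prop where
  f : 0 < F
  p : 0 < o
  q : 0 ≤ s
  h0 : 0 ≤ 0.8651 - 0.859 * F - o
  h1 : 0 ≤ 0.8488 - F - 0.824 * s
  h2 : 0 ≤ 0.9516 - 0.371 * F - o - 0.674 * s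
  h3 : 0 ≤ 0.4654 - F

structure TC (F o s : ℝ) : Prop where
  f : 0 < F
  p : 0 < o
  q : 0 ≤ s
  h0 : 0 ≤ 0.8651 - 0.859 * o - s
  h1 : 0 ≤ 0.8652 - o - 0.859 * s
  h2 : 0 ≤ 1.6385 - F - 0.521 * o
  h3 : 0 ≤ 0.6498 - o
  h4 : 0 ≤ 1.8703 - 0.871 * F - o - 0.406 * s
  h5 : 0 ≤ 1.3961 - F

structure TD (F o s : ℝ) : Prop where
  f : 0 < F
  p : 0 < o
  q : 0 ≤ s
  h0 : 0 ≤ 1.0 - o - 0.453 * s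
  h1 : 0 ≤ 1.742 - F - 0.742 * o
  h2 : 0 ≤ 1.3961 - F

lemma TA.of {F o s : ℝ} (f : 0 < F) (p : 0 < o) (q : 0 < s)
    (h0 : 0 ≤ 1.1177 * 1.466 - F - 0.507 * o)
    (h1 : 0 ≤ 0.6822 * 1.466 - F)
    (h2 : 0 ≤ 1.3296 * 1.466 - o)
    (h3 : 0 ≤ 1.395 * 1.466 - F - 0.674 * o - 0.371 * s)
    (h4 : 0 ≤ 1.2443 * 1.466 - 0.824 * o - s)
    (h5 : 0 ≤ 0.6822 * 1.466 - s)
    : TA (F / 1.466) (o / 1.466) (s / 1.466) := by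
  have k : (1.466 : ℝ) ≠ 0 := by norm_num
  obtain ⟨F, rfl⟩ : ∃ x, F = x * 1.466 := ⟨F / 1.466, (div_mul_cancel₀ F k).symm⟩
  obtain ⟨o, rfl⟩ : ∃ x, o = x * 1.466 := ⟨o / 1.466, (div_mul_cancel₀ o k).symm⟩
  obtain ⟨s, rfl⟩ : ∃ x, s = x * 1.466 := ⟨s / 1.466, (div_mul_cancel₀ s k).symm⟩
  rw [mul_div_cancel_right₀ _ k, mul_div_cancel_right₀ _ k, mul_div_cancel_right₀ _ k]
  constructor <;> linarith

lemma TB.of {F o s : ℝ} (f : 0 < F) (p : 0 < o) (q : 0 < s)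
    (h0 : 0 ≤ 0.8651 * 1.466 - 0.859 * F - o)
    (h1 : 0 ≤ 0.8488 * 1.466 - F - 0.824 * s)
    (h2 : 0 ≤ 0.9516 * 1.466 - 0.371 * F - o - 0.674 * s)
    (h3 : 0 ≤ 0.4654 * 1.466 - F)
    : TB (F / 1.466) (o / 1.466) (s / 1.466) := by
  have k : (1.466 : ℝ) ≠ 0 := by norm_num
  obtain ⟨F, rfl⟩ : ∃ x, F = x * 1.466 := ⟨F / 1.466, (div_mul_cancel₀ F k).symm⟩
  obtain ⟨o, rfl⟩ : ∃ x, o = x * 1.466 := ⟨o / 1.466, (div_mul_cancel₀ o k).symm⟩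
  obtain ⟨s, rfl⟩ : ∃ x, s = x * 1.466 := ⟨s / 1.466, (div_mul_cancel₀ s k).symm⟩
  rw [mul_div_cancel_right₀ _ k, mul_div_cancel_right₀ _ k, mul_div_cancel_right₀ _ k]
  constructor <;> linarith

lemma tCC {F1 o1 s1 F2 o2 s2 : ℝ} (x : TC F1 o1 s1) (y : TC F2 o2 s2) :
    TA ((o1 * o2 + s1 * o2 + o1 * s2) / 1.466) (F1 * F2 / 1.466) (o1 * o2 / 1.466) := by
  have := x.f; have := x.p; have := x.q; have := y.f; have := y.p; have := y.q
  refine TA.of ?_ ?_ ?_ ?_ ?_ ?_ ?_ ?_ ?_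
  · positivity
  · positivity
  · positivity
  · rcases le_total o1 0.45 with w | w
    · linarith [mul_nonneg x.h5 y.f.le, mul_nonneg x.h4 y.f.le, mul_nonneg x.h0 y.p.le,
      mul_nonneg x.f.le y.h2, mul_nonneg x.f.le y.h4, y.h5,
      mul_nonneg x.h2 y.h3, mul_nonneg x.h4 y.h0, mul_nonneg x.p.le y.h1,
      mul_nonneg (sub_nonneg.2 w) y.f.le, mul_nonneg x.q y.h0, mul_nonneg (sub_nonneg.2 w) y.q,
      mul_nonneg x.q y.h3, mul_nonneg x.h0 y.h2, mul_nonneg x.p.le y.h2,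
      mul_nonneg x.h2 y.h5]
    · linarith [mul_nonneg x.p.le y.h0, mul_nonneg x.h4 y.f.le, mul_nonneg (sub_nonneg.2 w) y.h1,
      mul_nonneg (sub_nonneg.2 w) y.h5, mul_nonneg x.f.le y.h4, mul_nonneg (sub_nonneg.2 w) y.h0,
      mul_nonneg x.h2 y.h0, mul_nonneg x.h1 y.f.le, mul_nonneg x.h1 y.h3,
      mul_nonneg (sub_nonneg.2 w) y.p.le, mul_nonneg x.q y.h4, mul_nonneg x.h2 y.h3,
      mul_nonneg x.h0 y.h0, mul_nonneg x.h3 y.h3, mul_nonneg x.f.le y.h1,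
      mul_nonneg x.h0 y.h5]
  · linarith [mul_nonneg x.q y.h0, mul_nonneg x.h3 y.q, mul_nonneg x.h4 y.h0,
      mul_nonneg x.p.le y.h1, mul_nonneg x.h3 y.h5, mul_nonneg x.h3 y.f.le,
      mul_nonneg x.h0 y.f.le, mul_nonneg x.q y.h3, mul_nonneg x.h0 y.h2,
      mul_nonneg x.h1 y.p.le, mul_nonneg x.f.le y.h0]
  · linarith [mul_nonneg x.h0 y.p.le, mul_nonneg x.h5 y.f.le, mul_nonneg x.f.le y.p.le,
      mul_nonneg x.f.le y.q, mul_nonneg x.f.le y.h5, mul_nonneg x.h4 y.h5,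
      mul_nonneg x.h4 y.h4, mul_nonneg x.h5 y.p.le, mul_nonneg x.p.le y.f.le,
      mul_nonneg x.h5 y.q, mul_nonneg x.p.le y.h5, mul_nonneg x.p.le y.h3,
      mul_nonneg x.q y.h0, mul_nonneg x.h3 y.q, mul_nonneg x.q y.h5,
      mul_nonneg x.q y.h3]
  · rcases le_total o1 0.45 with w | w
    · linarith [mul_nonneg x.h0 y.q, mul_nonneg x.f.le y.h0, mul_nonneg x.h1 y.p.le,
      mul_nonneg (sub_nonneg.2 w) y.q, mul_nonneg x.f.le y.h4, mul_nonneg x.h5 y.f.le,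
      mul_nonneg x.h2 y.h3, mul_nonneg x.h2 y.h0, mul_nonneg x.p.le y.h1,
      mul_nonneg (sub_nonneg.2 w) y.f.le, mul_nonneg x.p.le y.h2, y.h5,
      mul_nonneg x.q y.h3, mul_nonneg x.h0 y.h4, mul_nonneg x.h4 y.h5,
      mul_nonneg x.q y.h2]
    · linarith [mul_nonneg (sub_nonneg.2 w) y.h5, mul_nonneg x.h4 y.f.le, mul_nonneg (sub_nonneg.2 w) y.h1,
      mul_nonneg x.h4 y.h3, mul_nonneg x.f.le y.h4, mul_nonneg x.h3 y.p.le,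
      mul_nonneg x.h2 y.h0, mul_nonneg x.h5 y.h5, mul_nonneg x.f.le y.h1,
      mul_nonneg x.q y.h4, mul_nonneg x.h1 y.p.le, mul_nonneg x.h2 y.f.le,
      mul_nonneg x.h3 y.f.le, mul_nonneg x.h0 y.h5, mul_nonneg x.p.le y.h5,
      mul_nonneg x.h0 y.h0]
  · rcases le_total o1 0.45 with w | w
    · linarith [mul_nonneg x.h5 y.f.le, mul_nonneg x.p.le y.h3, mul_nonneg x.f.le y.h5,
      mul_nonneg x.q y.h5, mul_nonneg x.p.le y.h2, mul_nonneg x.h4 y.h5,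
      mul_nonneg (sub_nonneg.2 w) y.p.le, mul_nonneg x.h5 y.h3, mul_nonneg (sub_nonneg.2 w) y.f.le,
      mul_nonneg x.f.le y.h2]
    · linarith [mul_nonneg (sub_nonneg.2 w) y.h3, mul_nonneg x.h3 y.h5, mul_nonneg x.h2 y.f.le,
      mul_nonneg x.f.le y.h5, mul_nonneg x.q y.h5, mul_nonneg x.h5 y.h3,
      mul_nonneg x.p.le y.h2, mul_nonneg x.h4 y.h5, mul_nonneg x.h5 y.f.le,
      mul_nonneg x.f.le y.h2]
  · linarith [mul_nonneg x.p.le y.h3, mul_nonneg x.h3 y.h5, mul_nonneg x.h3 y.f.le]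

lemma tCD {F1 o1 s1 F2 o2 s2 : ℝ} (x : TC F1 o1 s1) (y : TD F2 o2 s2) :
    TA ((o1 * o2 + s1 * o2) / 1.466) (F1 * F2 / 1.466) (o1 * o2 / 1.466) := by
  have := x.f; have := x.p; have := x.q; have := y.f; have := y.p; have := y.q
  refine TA.of ?_ ?_ ?_ ?_ ?_ ?_ ?_ ?_ ?_
  · positivity
  · positivity
  · positivity
  · linarith [mul_nonneg x.p.le y.h0, mul_nonneg x.h1 y.p.le, mul_nonneg x.p.le y.q,
      mul_nonneg x.f.le y.h1, mul_nonneg x.h5 y.q, mul_nonneg x.h5 y.h0,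
      x.h5, mul_nonneg x.h0 y.p.le, x.h0,
      mul_nonneg x.q y.h0, x.h2, mul_nonneg x.q y.q]
  · linarith [mul_nonneg x.h1 y.p.le, y.q, mul_nonneg x.h5 y.h0,
      mul_nonneg x.p.le y.f.le, mul_nonneg x.h0 y.h2, mul_nonneg x.f.le y.h0,
      mul_nonneg x.q y.h0, mul_nonneg x.p.le y.h2, mul_nonneg x.h0 y.f.le,
      mul_nonneg x.q y.q]
  · linarith [mul_nonneg x.h5 y.f.le, mul_nonneg x.h0 y.p.le, mul_nonneg x.f.le y.h2,
      mul_nonneg x.h4 y.h2, mul_nonneg x.h4 y.h1, mul_nonneg x.p.le y.h0,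
      mul_nonneg x.p.le y.f.le, mul_nonneg x.h5 y.p.le, mul_nonneg x.p.le y.h2,
      mul_nonneg x.p.le y.q, mul_nonneg x.q y.h0, mul_nonneg x.h3 y.p.le,
      mul_nonneg x.q y.h2, mul_nonneg x.q y.q]
  · linarith [mul_nonneg x.h3 y.h2, mul_nonneg x.h4 y.f.le, mul_nonneg x.h1 y.p.le,
      mul_nonneg x.f.le y.q, mul_nonneg x.f.le y.h1, mul_nonneg x.h5 y.q,
      mul_nonneg x.h5 y.h0, x.h5, mul_nonneg x.p.le y.h0,
      mul_nonneg x.h0 y.h1, mul_nonneg x.h3 y.h1, mul_nonneg x.p.le y.q,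
      mul_nonneg x.q y.h0, mul_nonneg x.h2 y.h2, mul_nonneg x.f.le y.h0,
      mul_nonneg x.q y.q]
  · linarith [mul_nonneg x.h5 y.f.le, mul_nonneg x.h3 y.p.le, mul_nonneg x.h5 y.q,
      mul_nonneg x.f.le y.h2, mul_nonneg x.q y.h2, mul_nonneg x.f.le y.h1,
      mul_nonneg x.p.le y.h1, mul_nonneg x.h4 y.h2, mul_nonneg x.h3 y.h2,
      mul_nonneg x.h2 y.f.le, mul_nonneg x.h5 y.h0]
  · linarith [mul_nonneg x.h3 y.p.le, y.q, mul_nonneg x.h5 y.h0,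
      mul_nonneg x.f.le y.h0]

lemma tDD {F1 o1 s1 F2 o2 s2 : ℝ} (x : TD F1 o1 s1) (y : TD F2 o2 s2) :
    TA ((o1 * o2) / 1.466) (F1 * F2 / 1.466) (o1 * o2 / 1.466) := by
  have := x.f; have := x.p; have := x.q; have := y.f; have := y.p; have := y.q
  refine TA.of ?_ ?_ ?_ ?_ ?_ ?_ ?_ ?_ ?_
  · positivity
  · positivity
  · positivity
  · linarith [mul_nonneg x.p.le y.h0, mul_nonneg x.h2 y.f.le, mul_nonneg x.h0 y.p.le,
      y.q, mul_nonneg x.f.le y.h1, mul_nonneg x.h1 y.h0,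
      mul_nonneg x.f.le y.h0, mul_nonneg x.p.le y.h1, mul_nonneg x.h1 y.h2,
      mul_nonneg x.h1 y.f.le, mul_nonneg x.h2 y.q, mul_nonneg x.h0 y.q,
      mul_nonneg x.q y.p.le, mul_nonneg x.q y.q]
  · linarith [mul_nonneg x.h0 y.p.le, y.q, mul_nonneg x.h1 y.h0,
      mul_nonneg x.p.le y.h0, mul_nonneg x.f.le y.h0, mul_nonneg x.q y.p.le]
  · linarith [mul_nonneg x.h2 y.f.le, mul_nonneg x.h0 y.p.le, mul_nonneg x.f.le y.h2,
      mul_nonneg x.h1 y.h2, mul_nonneg x.h1 y.h1, mul_nonneg x.p.le y.h0,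
      mul_nonneg x.h2 y.p.le, mul_nonneg x.p.le y.h2, mul_nonneg x.p.le y.q,
      mul_nonneg x.p.le y.h1, mul_nonneg x.q y.p.le]
  · linarith [mul_nonneg x.p.le y.h0, mul_nonneg x.h2 y.f.le, mul_nonneg x.h0 y.p.le,
      y.q, mul_nonneg x.f.le y.h1, mul_nonneg x.h1 y.h0,
      mul_nonneg x.p.le y.q, mul_nonneg x.p.le y.h1, mul_nonneg x.h1 y.h2,
      mul_nonneg x.h0 y.h2, mul_nonneg x.h2 y.q, mul_nonneg x.q y.h2,
      mul_nonneg x.q y.p.le, mul_nonneg x.h1 y.f.le]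
  · rcases le_total F1 1.1 with w | w
    · linarith [mul_nonneg x.h1 y.f.le, mul_nonneg x.h0 y.p.le, mul_nonneg x.f.le y.h1,
      mul_nonneg x.p.le y.q, mul_nonneg (sub_nonneg.2 w) y.q, mul_nonneg x.p.le y.h0,
      mul_nonneg x.p.le y.h1, mul_nonneg x.h1 y.h2, mul_nonneg x.h1 y.p.le,
      mul_nonneg (sub_nonneg.2 w) y.f.le, mul_nonneg x.q y.p.le, mul_nonneg (sub_nonneg.2 w) y.h0]
    · linarith [mul_nonneg x.p.le y.h0, mul_nonneg x.h2 y.f.le, mul_nonneg x.h0 y.h2,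
      mul_nonneg x.h0 y.h1, mul_nonneg (sub_nonneg.2 w) y.h2, mul_nonneg x.p.le y.q,
      mul_nonneg x.p.le y.h1, mul_nonneg x.h2 y.h0, mul_nonneg x.q y.h1,
      mul_nonneg x.h2 y.q, mul_nonneg x.q y.h2, mul_nonneg x.h1 y.f.le,
      mul_nonneg x.h1 y.p.le]
  · linarith [mul_nonneg x.h0 y.p.le, y.q, mul_nonneg x.h1 y.h0,
      mul_nonneg x.p.le y.h0, mul_nonneg x.f.le y.h0, mul_nonneg x.q y.p.le]

lemma tCA {F1 o1 s1 F2 o2 s2 : ℝ} (x : TC F1 o1 s1) (y : TA F2 o2 s2) :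
    TB ((o1 * s2) / 1.466) (F1 * F2 / 1.466) (o1 * o2 / 1.466) := by
  have := x.f; have := x.p; have := x.q; have := y.f; have := y.p; have := y.q
  refine TB.of ?_ ?_ ?_ ?_ ?_ ?_ ?_
  · positivity
  · positivity
  · positivity
  · linarith [mul_nonneg x.p.le y.p.le, mul_nonneg x.h5 y.h2, mul_nonneg x.h3 y.q.le,
      mul_nonneg x.f.le y.h1, mul_nonneg x.h2 y.h2, mul_nonneg x.h2 y.h4,
      mul_nonneg x.h2 y.p.le, mul_nonneg x.h3 y.h2, mul_nonneg x.f.le y.h5,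
      mul_nonneg x.p.le y.h5]
  · linarith [mul_nonneg x.p.le y.h4, x.h3]
  · linarith [mul_nonneg x.f.le y.h1, mul_nonneg x.h3 y.p.le, mul_nonneg x.q y.p.le,
      mul_nonneg x.f.le y.h3, mul_nonneg x.f.le y.h5, mul_nonneg x.h5 y.h2,
      mul_nonneg x.h0 y.q.le, mul_nonneg x.p.le y.h4, mul_nonneg x.h2 y.p.le,
      mul_nonneg x.h3 y.q.le, mul_nonneg x.h5 y.h4, mul_nonneg x.q y.h4,
      mul_nonneg x.h4 y.h5]
  · linarith [mul_nonneg x.p.le y.h5, mul_nonneg x.h3 y.h2, mul_nonneg x.h3 y.p.le]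

lemma tDA {F1 o1 s1 F2 o2 s2 : ℝ} (x : TD F1 o1 s1) (y : TA F2 o2 s2) :
    TB ((o1 * s2) / 1.466) (F1 * F2 / 1.466) (o1 * o2 / 1.466) := by
  have := x.f; have := x.p; have := x.q; have := y.f; have := y.p; have := y.q
  refine TB.of ?_ ?_ ?_ ?_ ?_ ?_ ?_
  · positivity
  · positivity
  · positivity
  · linarith [mul_nonneg x.p.le y.p.le, mul_nonneg x.q y.p.le, mul_nonneg x.f.le y.h1,
      mul_nonneg x.p.le y.h5, mul_nonneg x.h1 y.h2, mul_nonneg x.f.le y.h2,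
      mul_nonneg x.h1 y.p.le, mul_nonneg x.h0 y.h2, mul_nonneg x.q y.h2,
      mul_nonneg x.h0 y.p.le]
  · linarith [mul_nonneg x.p.le y.h4, x.h0, x.q]
  · linarith [mul_nonneg x.q y.p.le, mul_nonneg x.p.le y.h3, mul_nonneg x.q y.h5,
      mul_nonneg x.h1 y.q.le, mul_nonneg x.f.le y.h1, mul_nonneg x.q y.h2,
      mul_nonneg x.h2 y.h3, mul_nonneg x.f.le y.h0, mul_nonneg x.p.le y.h4,
      mul_nonneg x.h0 y.h0, mul_nonneg x.h0 y.p.le, mul_nonneg x.q y.h1,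
      mul_nonneg x.h0 y.h1, mul_nonneg x.h1 y.f.le, mul_nonneg x.h1 y.p.le,
      mul_nonneg x.h0 y.h5]
  · linarith [mul_nonneg x.p.le y.h5, mul_nonneg x.h0 y.h2, mul_nonneg x.h0 y.p.le,
      x.q]

lemma tCB {F1 o1 s1 F2 o2 s2 : ℝ} (x : TC F1 o1 s1) (y : TB F2 o2 s2) :
    TC (F1 * F2 + o1 * o2 + o1 * s2 + s1 * o2) (F1 * F2) (o1 * o2) := by
  have := x.f; have := x.p; have := x.q; have := y.f; have := y.p; have := y.q
  refine ⟨?_, ?_, ?_, ?_, ?_, ?_, ?_, ?_, ?_⟩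
  · positivity
  · positivity
  · positivity
  · linarith [mul_nonneg x.h5 y.q, mul_nonneg x.h5 y.f.le, mul_nonneg x.h3 y.p.le,
      mul_nonneg x.h0 y.q, mul_nonneg x.f.le y.q, mul_nonneg x.h1 y.h3,
      mul_nonneg x.h4 y.h0, mul_nonneg x.h5 y.h1, mul_nonneg x.p.le y.h0,
      mul_nonneg x.h1 y.h1, mul_nonneg x.f.le y.h3, x.h2,
      mul_nonneg x.q y.h2, mul_nonneg x.h3 y.q, mul_nonneg x.f.le y.h0,
      mul_nonneg x.q y.h3]
  · linarith [mul_nonneg x.h5 y.f.le, mul_nonneg x.h3 y.p.le, mul_nonneg x.q y.h0,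
      mul_nonneg x.h2 y.f.le, mul_nonneg x.h4 y.h0, mul_nonneg x.h1 y.h3,
      mul_nonneg x.p.le y.h0, mul_nonneg x.f.le y.h3, x.h2,
      mul_nonneg x.f.le y.h0, mul_nonneg x.q y.h3]
  · linarith [mul_nonneg x.f.le y.h3, mul_nonneg x.h5 y.f.le, mul_nonneg x.h1 y.p.le,
      mul_nonneg x.h2 y.q, mul_nonneg x.f.le y.h1, mul_nonneg x.p.le y.h2,
      mul_nonneg x.h5 y.h2, mul_nonneg x.f.le y.h0, mul_nonneg x.p.le y.h1,
      mul_nonneg x.h1 y.h3, mul_nonneg x.h2 y.p.le, x.h3,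
      mul_nonneg x.q y.h0, mul_nonneg x.h4 y.f.le, mul_nonneg x.q y.h3]
  · linarith [x.f.le, mul_nonneg x.f.le y.h3, x.h5]
  · linarith [mul_nonneg x.f.le y.h3, mul_nonneg x.h2 y.f.le, mul_nonneg x.h1 y.p.le,
      mul_nonneg x.h2 y.q, mul_nonneg x.h1 y.h3, mul_nonneg x.p.le y.h0,
      mul_nonneg x.h5 y.h2, mul_nonneg x.f.le y.h0, mul_nonneg x.p.le y.h2,
      mul_nonneg x.h1 y.h1, x.h4, mul_nonneg x.h3 y.q,
      mul_nonneg x.q y.h2, mul_nonneg x.p.le y.h1, mul_nonneg x.q y.h0,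
      mul_nonneg x.h4 y.f.le]
  · linarith [mul_nonneg x.p.le y.h1, mul_nonneg x.q y.h3, mul_nonneg x.h1 y.p.le,
      mul_nonneg x.h2 y.q, mul_nonneg x.f.le y.h1, mul_nonneg x.h5 y.f.le,
      mul_nonneg x.h5 y.h2, mul_nonneg x.f.le y.h0, mul_nonneg x.h3 y.q,
      mul_nonneg x.h1 y.h3, mul_nonneg x.f.le y.h2, x.h0,
      mul_nonneg x.q y.h0, x.h3, mul_nonneg x.p.le y.p.le]

lemma tDB {F1 o1 s1 F2 o2 s2 : ℝ} (x : TD F1 o1 s1) (y : TB F2 o2 s2) :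
    TC (F1 * F2 + o1 * o2 + o1 * s2) (F1 * F2) (o1 * o2) := by
  have := x.f; have := x.p; have := x.q; have := y.f; have := y.p; have := y.q
  refine ⟨?_, ?_, ?_, ?_, ?_, ?_, ?_, ?_, ?_⟩
  · positivity
  · positivity
  · positivity
  · linarith [mul_nonneg x.q y.h3, mul_nonneg x.h0 y.h3, mul_nonneg x.p.le y.h0,
      mul_nonneg x.h0 y.h1, mul_nonneg x.h1 y.f.le, x.q,
      mul_nonneg x.h0 y.q]
  · linarith [x.h1, mul_nonneg x.h2 y.f.le, mul_nonneg x.f.le y.h3,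
      mul_nonneg x.h0 y.h3, mul_nonneg x.p.le y.h0, mul_nonneg x.h0 y.h1,
      mul_nonneg x.q y.h3, mul_nonneg x.h1 y.f.le, x.q,
      mul_nonneg x.h0 y.q]
  · linarith [x.h1, mul_nonneg x.h2 y.f.le, mul_nonneg x.f.le y.h3,
      mul_nonneg x.h1 y.f.le, mul_nonneg x.p.le y.h2, mul_nonneg x.h0 y.h3,
      mul_nonneg x.q y.h3, mul_nonneg x.p.le y.h1, x.q,
      x.h0]
  · linarith [mul_nonneg x.f.le y.h3, x.h2, x.f.le]
  · linarith [x.h1, mul_nonneg x.h2 y.f.le, mul_nonneg x.f.le y.h3,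
      mul_nonneg x.h1 y.f.le, mul_nonneg x.p.le y.h2, mul_nonneg x.h0 y.h3,
      mul_nonneg x.q y.h3, mul_nonneg x.p.le y.h1, x.q,
      x.h0]
  · linarith [x.h1, mul_nonneg x.h2 y.f.le, mul_nonneg x.f.le y.h3,
      mul_nonneg x.h1 y.f.le, mul_nonneg x.p.le y.h2, mul_nonneg x.h0 y.h3,
      mul_nonneg x.q y.h3, mul_nonneg x.p.le y.h1, x.q,
      x.h0]

lemma tAA {F1 o1 s1 F2 o2 s2 : ℝ} (x : TA F1 o1 s1) (y : TA F2 o2 s2) :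
    TD (F1 * F2 + s1 * o2 + o1 * s2) (F1 * F2) (o1 * o2) := by
  have := x.f; have := x.p; have := x.q; have := y.f; have := y.p; have := y.q
  refine ⟨?_, ?_, ?_, ?_, ?_, ?_⟩
  · positivity
  · positivity
  · positivity
  · linarith [mul_nonneg x.h4 y.p.le, mul_nonneg x.h2 y.h1, mul_nonneg x.h2 y.p.le,
      mul_nonneg x.h2 y.q.le, mul_nonneg x.p.le y.q.le, mul_nonneg x.h4 y.h2,
      mul_nonneg x.h3 y.h4, mul_nonneg x.h0 y.p.le, mul_nonneg x.p.le y.h2,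
      mul_nonneg x.h4 y.h0, mul_nonneg x.h0 y.f.le, mul_nonneg x.h1 y.q.le,
      mul_nonneg x.q.le y.h3, mul_nonneg x.p.le y.h0, mul_nonneg x.f.le y.h3,
      mul_nonneg x.q.le y.q.le]
  · linarith [mul_nonneg x.q.le y.h3, mul_nonneg x.h1 y.f.le, mul_nonneg x.q.le y.h4,
      mul_nonneg x.h3 y.q.le, mul_nonneg x.f.le y.h1, mul_nonneg x.h1 y.p.le,
      mul_nonneg x.h1 y.h4, mul_nonneg x.h4 y.q.le, mul_nonneg x.h2 y.h0,
      mul_nonneg x.h4 y.h1, mul_nonneg x.h5 y.p.le, mul_nonneg x.h2 y.h4,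
      mul_nonneg x.h5 y.h1, mul_nonneg x.p.le y.h3, mul_nonneg x.p.le y.h5,
      mul_nonneg x.h5 y.h5]
  · linarith [mul_nonneg x.h3 y.f.le, mul_nonneg x.h1 y.f.le, mul_nonneg x.h3 y.q.le,
      mul_nonneg x.h1 y.h5, mul_nonneg x.h4 y.h1, mul_nonneg x.p.le y.h5,
      mul_nonneg x.h5 y.h1, mul_nonneg x.q.le y.h4, mul_nonneg x.f.le y.h1,
      mul_nonneg x.q.le y.h3, mul_nonneg x.h0 y.f.le, mul_nonneg x.h4 y.q.le,
      mul_nonneg x.h5 y.h5]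

lemma tAB {F1 o1 s1 F2 o2 s2 : ℝ} (x : TA F1 o1 s1) (y : TB F2 o2 s2) :
    TD (F1 * F2 + s1 * o2) (F1 * F2) (o1 * o2) := by
  have := x.f; have := x.p; have := x.q; have := y.f; have := y.p; have := y.q
  refine ⟨?_, ?_, ?_, ?_, ?_, ?_⟩
  · positivity
  · positivity
  · positivity
  · linarith [mul_nonneg x.p.le y.f.le, mul_nonneg x.h1 y.f.le, mul_nonneg x.p.le y.p.le,
      mul_nonneg x.h2 y.h3, x.h2, mul_nonneg x.p.le y.h0]
  · linarith [mul_nonneg x.h1 y.f.le, mul_nonneg x.h5 y.q, mul_nonneg x.h2 y.h1,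
      x.p.le, mul_nonneg x.h4 y.h1, mul_nonneg x.p.le y.h3,
      mul_nonneg x.q.le y.h0, mul_nonneg x.h2 y.q, mul_nonneg x.p.le y.h1,
      x.h5]
  · linarith [mul_nonneg x.h1 y.f.le, mul_nonneg x.h5 y.q, mul_nonneg x.p.le y.h1,
      x.p.le, mul_nonneg x.h4 y.h1, mul_nonneg x.p.le y.h3,
      mul_nonneg x.q.le y.h0, mul_nonneg x.h2 y.q, mul_nonneg x.q.le y.f.le,
      x.h5]

lemma tBB {F1 o1 s1 F2 o2 s2 : ℝ} (x : TB F1 o1 s1) (y : TB F2 o2 s2) :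
    TD (F1 * F2) (F1 * F2) (o1 * o2) := by
  have := x.f; have := x.p; have := x.q; have := y.f; have := y.p; have := y.q
  refine ⟨?_, ?_, ?_, ?_, ?_, ?_⟩
  · positivity
  · positivity
  · positivity
  · linarith [mul_nonneg x.q y.q, y.f.le, mul_nonneg x.h0 y.p.le,
      y.q, mul_nonneg x.f.le y.h3, x.h1,
      mul_nonneg x.h1 y.h2, y.h0, x.f.le,
      mul_nonneg x.q y.h1, mul_nonneg x.h3 y.q, mul_nonneg x.q y.h0,
      mul_nonneg x.q y.f.le]
  · linarith [mul_nonneg x.f.le y.h3, x.h3]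
  · linarith [mul_nonneg x.f.le y.h3, x.h3]

def Kt (a b : ℤ) (F o s : ℝ) : Prop :=
  (a = 1 ∧ b = 0 ∧ TA F o s) ∨ (a = 1 ∧ b = 1 ∧ TB F o s) ∨ (a = 0 ∧ b = 0 ∧ TC F o s) ∨
    (a = 0 ∧ b = 1 ∧ TD F o s)

def Good {V : Type*} (G : SimpleGraph V) (W R : Finset V) : Prop :=
  ∃ a b F o s, St G W R a b F o s ∧ Kt a b F o s

lemma good_nil {V : Type*} (G : SimpleGraph V) : Good G ∅ ∅ := by
  have hA : ∀ F, F ∈ famA G ∅ ↔ F = ∅ := by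
    intro F
    rw [mem_famA, Finset.subset_empty]
    constructor
    · exact fun h => h.1
    · rintro rfl
      exact ⟨rfl, fun v hv => by simp at hv⟩
  have hA' : famA G ∅ = {∅} := by ext F; rw [hA, Finset.mem_singleton]
  have hO : famO G ∅ ∅ = {∅} := by
    ext F; rw [mem_famO, ← mem_famA, hA, Finset.mem_singleton]; simp
  have hS : famS G ∅ ∅ = ∅ := by
    ext F; rw [mem_famS]; simp
  refine ⟨0, 1, 1, 1, 0, ⟨0, ?_, ?_, ?_⟩, Or.inr (Or.inr (Or.inr ⟨rfl, rfl, ?_⟩))⟩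
  · rw [hA']; constructor <;> simp [Finset.filter_singleton]
  · rw [hO]; constructor <;> simp [Finset.filter_singleton]
  · rw [hS]; constructor <;> simp
  · constructor <;> norm_num

lemma NodeHyp.good {V : Type*} [DecidableEq V] {G : SimpleGraph V} {r : V}
    {W1 R1 W2 R2 : Finset V} (h : NodeHyp G r W1 R1 W2 R2) (g1 : Good G W1 R1)
    (g2 : Good G W2 R2) : Good G (insert r (W1 ∪ W2)) {r} := by
  obtain ⟨a1, b1, F1, o1, s1, h1, k1⟩ := g1
  obtain ⟨a2, b2, F2, o2, s2, h2, k2⟩ := g2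
  have hs := h.symm
  rcases k1 with ⟨rfl, rfl, x⟩ | ⟨rfl, rfl, x⟩ | ⟨rfl, rfl, x⟩ | ⟨rfl, rfl, x⟩ <;>
  rcases k2 with ⟨rfl, rfl, y⟩ | ⟨rfl, rfl, y⟩ | ⟨rfl, rfl, y⟩ | ⟨rfl, rfl, y⟩
  · refine ⟨_, _, _, _, _, h.combine h1 h2 0 ?_ ?_ ?_ ?_, ?_⟩ <;> try omega
    exact Or.inr (Or.inr (Or.inr ⟨rfl, rfl, by simpa using tAA x y⟩))
  · refine ⟨_, _, _, _, _, h.combine h1 h2 0 ?_ ?_ ?_ ?_, ?_⟩ <;> try omega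
    exact Or.inr (Or.inr (Or.inr ⟨rfl, rfl, by simpa using tAB x y⟩))
  · rw [Finset.union_comm]
    refine ⟨_, _, _, _, _, hs.combine h2 h1 1 ?_ ?_ ?_ ?_, ?_⟩ <;> try omega
    exact Or.inr (Or.inl ⟨rfl, rfl, by simpa using tCA y x⟩)
  · rw [Finset.union_comm]
    refine ⟨_, _, _, _, _, hs.combine h2 h1 1 ?_ ?_ ?_ ?_, ?_⟩ <;> try omega
    exact Or.inr (Or.inl ⟨rfl, rfl, by simpa using tDA y x⟩)
  · rw [Finset.union_comm]
    refine ⟨_, _, _, _, _, hs.combine h2 h1 0 ?_ ?_ ?_ ?_, ?_⟩ <;> try omega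
    exact Or.inr (Or.inr (Or.inr ⟨rfl, rfl, by simpa using tAB y x⟩))
  · refine ⟨_, _, _, _, _, h.combine h1 h2 0 ?_ ?_ ?_ ?_, ?_⟩ <;> try omega
    exact Or.inr (Or.inr (Or.inr ⟨rfl, rfl, by simpa using tBB x y⟩))
  · rw [Finset.union_comm]
    refine ⟨_, _, _, _, _, hs.combine h2 h1 0 ?_ ?_ ?_ ?_, ?_⟩ <;> try omega
    exact Or.inr (Or.inr (Or.inl ⟨rfl, rfl, by convert tCB y x using 1 <;> simp <;> ring⟩))
  · rw [Finset.union_comm]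
    refine ⟨_, _, _, _, _, hs.combine h2 h1 0 ?_ ?_ ?_ ?_, ?_⟩ <;> try omega
    exact Or.inr (Or.inr (Or.inl ⟨rfl, rfl, by simpa using tDB y x⟩))
  · refine ⟨_, _, _, _, _, h.combine h1 h2 1 ?_ ?_ ?_ ?_, ?_⟩ <;> try omega
    exact Or.inr (Or.inl ⟨rfl, rfl, by simpa using tCA x y⟩)
  · refine ⟨_, _, _, _, _, h.combine h1 h2 0 ?_ ?_ ?_ ?_, ?_⟩ <;> try omega
    exact Or.inr (Or.inr (Or.inl ⟨rfl, rfl, by convert tCB x y using 1 <;> simp <;> ring⟩))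
  · refine ⟨_, _, _, _, _, h.combine h1 h2 1 ?_ ?_ ?_ ?_, ?_⟩ <;> try omega
    exact Or.inl ⟨rfl, rfl, by simpa using tCC x y⟩
  · refine ⟨_, _, _, _, _, h.combine h1 h2 1 ?_ ?_ ?_ ?_, ?_⟩ <;> try omega
    exact Or.inl ⟨rfl, rfl, by simpa using tCD x y⟩
  · refine ⟨_, _, _, _, _, h.combine h1 h2 1 ?_ ?_ ?_ ?_, ?_⟩ <;> try omega
    exact Or.inr (Or.inl ⟨rfl, rfl, by simpa using tDA x y⟩)
  · refine ⟨_, _, _, _, _, h.combine h1 h2 0 ?_ ?_ ?_ ?_, ?_⟩ <;> try omega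
    exact Or.inr (Or.inr (Or.inl ⟨rfl, rfl, by simpa using tDB x y⟩))
  · rw [Finset.union_comm]
    refine ⟨_, _, _, _, _, hs.combine h2 h1 1 ?_ ?_ ?_ ?_, ?_⟩ <;> try omega
    exact Or.inl ⟨rfl, rfl, by simpa using tCD y x⟩
  · refine ⟨_, _, _, _, _, h.combine h1 h2 1 ?_ ?_ ?_ ?_, ?_⟩ <;> try omega
    exact Or.inl ⟨rfl, rfl, by simpa using tDD x y⟩

def Rch {V : Type*} (G : SimpleGraph V) (W : Finset V) : V → V → Prop :=
  Relation.ReflTransGen (fun x y => G.Adj x y ∧ y ∈ W)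

lemma Rch.symm {V : Type*} {G : SimpleGraph V} {W : Finset V} {a x : V} (h : Rch G W a x)
    (ha : a ∈ W) : Rch G W x a := by
  have : x ∈ W ∧ Rch G W x a := by
    induction h with
    | refl => exact ⟨ha, Relation.ReflTransGen.refl⟩
    | tail _ e ih => exact ⟨e.2, Relation.ReflTransGen.head ⟨e.1.symm, ih.1⟩ ih.2⟩
  exact this.2

lemma acyc_branch {V : Type*} {G : SimpleGraph V} (hG : G.IsAcyclic) {W : Finset V} {r a b : V}
    (hr : r ∉ W) (ha : G.Adj r a) (hb : G.Adj r b) (hab : a ≠ b) : ¬ Rch G W a b := by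
  intro h
  have hbr := SimpleGraph.isAcyclic_iff_forall_adj_isBridge.1 hG hb
  rw [SimpleGraph.isBridge_iff] at hbr
  apply hbr
  have hra : (G.deleteEdges {s(r, b)}).Adj r a := by
    rw [SimpleGraph.deleteEdges_adj]
    refine ⟨ha, ?_⟩
    simp [hab, ha.ne']
  have : ∀ x, Rch G W a x → x ≠ r ∧ (G.deleteEdges {s(r, b)}).Reachable r x := by
    intro x hx
    induction hx with
    | refl => exact ⟨ha.ne', hra.reachable⟩
    | @tail y z _ e ih =>
      have hz : z ≠ r := fun q => hr (q ▸ e.2)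
      refine ⟨hz, ih.2.trans (SimpleGraph.Adj.reachable ?_)⟩
      rw [SimpleGraph.deleteEdges_adj]
      refine ⟨e.1, ?_⟩
      simp [ih.1, hz]
  exact (this b h).2

lemma good_of_tree {V : Type*} [Fintype V] [DecidableEq V] {G : SimpleGraph V} (hG : G.IsAcyclic)
    (hsub : Subcubic G) (W : Finset V) : ∀ (r : V), r ∈ W → (∀ x ∈ W, Rch G W r x) →
      (∃ c1 c2, ∀ x ∈ W, G.Adj r x → x = c1 ∨ x = c2) → Good G W {r} := by
  classical
  induction W using Finset.strongInduction with
  | H W IH =>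
  intro r hr hconn hdeg
  let W' := W.erase r
  have hrW' : r ∉ W' := by simp [W']
  let comp : V → Finset V := fun c => W'.filter (Rch G W' c)
  have hmem : ∀ c x, x ∈ comp c ↔ (x ∈ W' ∧ Rch G W' c x) := fun c x => Finset.mem_filter
  have hcov : ∀ x, Rch G W r x → x = r ∨ ∃ c ∈ W, G.Adj r c ∧ x ∈ comp c := by
    intro x hx
    induction hx with
    | refl => exact Or.inl rfl
    | @tail y z _ e ih =>
      by_cases hz : z = r
      · exact Or.inl hz
      right
      have hzW : z ∈ W' := Finset.mem_erase.2 ⟨hz, e.2⟩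
      rcases ih with rfl | ⟨c, hc, hrc, hy⟩
      · exact ⟨z, e.2, e.1, (hmem _ _).2 ⟨hzW, Relation.ReflTransGen.refl⟩⟩
      · exact ⟨c, hc, hrc, (hmem _ _).2 ⟨hzW, Relation.ReflTransGen.tail ((hmem _ _).1 hy).2
          ⟨e.1, hzW⟩⟩⟩
  have hcW' : ∀ c ∈ W, G.Adj r c → c ∈ W' := fun c hc hrc => Finset.mem_erase.2 ⟨hrc.ne', hc⟩
  have hself : ∀ c ∈ W, G.Adj r c → c ∈ comp c := fun c hc hrc =>
    (hmem _ _).2 ⟨hcW' c hc hrc, Relation.ReflTransGen.refl⟩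
  have hrc : ∀ c, r ∉ comp c := fun c q => hrW' ((hmem _ _).1 q).1
  have hbranch : ∀ c ∈ W, G.Adj r c → Good G (comp c) {c} := by
    intro c hc hadj
    apply IH
    · rw [Finset.ssubset_iff_of_subset]
      · exact ⟨r, hr, hrc c⟩
      · intro x hx
        exact Finset.mem_of_mem_erase ((hmem _ _).1 hx).1
    · exact hself c hc hadj
    · intro x hx
      have := ((hmem _ _).1 hx).2
      clear hx
      induction this with
      | refl => exact Relation.ReflTransGen.refl
      | tail h1 e ih =>
        exact ih.tail ⟨e.1, (hmem _ _).2 ⟨e.2, Relation.ReflTransGen.tail h1 e⟩⟩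
    · have h3 := hsub c
      have hfin : (G.neighborSet c).Finite := Set.toFinite _
      have hle : ((G.neighborSet c) \ {r}).ncard ≤ 2 := by
        have := Set.ncard_sdiff_singleton_add_one (s := G.neighborSet c) (a := r) hadj.symm hfin
        omega
      have key : ∃ c1 c2, ∀ x ∈ (G.neighborSet c) \ {r}, x = c1 ∨ x = c2 := by
        interval_cases hk : ((G.neighborSet c) \ {r}).ncard
        · rw [Set.ncard_eq_zero] at hk
          exact ⟨c, c, by simp [hk]⟩
        · obtain ⟨a, ha⟩ := Set.ncard_eq_one.1 hk
          exact ⟨a, a, by simp [ha]⟩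
        · obtain ⟨a, b, -, ha⟩ := Set.ncard_eq_two.1 hk
          exact ⟨a, b, by simp [ha]⟩
      obtain ⟨c1, c2, key⟩ := key
      refine ⟨c1, c2, fun x hx hcx => key x ⟨hcx, ?_⟩⟩
      rintro rfl
      exact hrc c hx
  have hadj : ∀ c ∈ W, G.Adj r c → ∀ x ∈ comp c, (G.Adj r x ↔ x ∈ ({c} : Finset V)) := by
    intro c hc h1 x hx
    rw [Finset.mem_singleton]
    constructor
    · intro h2
      by_contra hne
      exact acyc_branch hG hrW' h1 h2 (Ne.symm hne) ((hmem _ _).1 hx).2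
    · rintro rfl
      exact h1
  have hd : ∀ c ∈ W, G.Adj r c → ∀ d ∈ W, G.Adj r d → c ≠ d → Disjoint (comp c) (comp d) := by
    intro c hc h1 d hd h2 hne
    rw [Finset.disjoint_left]
    intro x hx hy
    exact acyc_branch hG hrW' h1 h2 hne
      (Relation.ReflTransGen.trans ((hmem _ _).1 hx).2 (((hmem _ _).1 hy).2.symm (hcW' d hd h2)))
  have he : ∀ c ∈ W, G.Adj r c → ∀ d ∈ W, G.Adj r d → c ≠ d →
      ∀ x ∈ comp c, ∀ y ∈ comp d, ¬ G.Adj x y := by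
    intro c hc h1 d hd h2 hne x hx y hy hxy
    have hx' := (hmem _ _).1 hx
    have hy' := (hmem _ _).1 hy
    exact acyc_branch hG hrW' h1 h2 hne
      (Relation.ReflTransGen.trans (hx'.2.tail ⟨hxy, hy'.1⟩) (hy'.2.symm (hcW' d hd h2)))
  have hsubW : ∀ c, comp c ⊆ W := fun c x hx => Finset.mem_of_mem_erase ((hmem _ _).1 hx).1
  -- one or no branch
  have one : ∀ c ∈ W, G.Adj r c → (∀ x ∈ W, G.Adj r x → x = c) → Good G W {r} := by
    intro c hc h1 hall
    have hW : W = insert r (comp c ∪ ∅) := by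
      ext x
      simp only [Finset.mem_insert, Finset.union_empty]
      constructor
      · intro hx
        rcases hcov x (hconn x hx) with q | ⟨d, hd, hrd, hxd⟩
        · exact Or.inl q
        · rw [hall d hd hrd] at hxd
          exact Or.inr hxd
      · rintro (rfl | q)
        · exact hr
        · exact hsubW c q
    have : NodeHyp G r (comp c) {c} ∅ ∅ :=
      ⟨hrc c, by simp, by simp, by simpa using hself c hc h1, by simp, by simp, by simp, by simp,
        hadj c hc h1, by simp⟩
    rw [hW]
    exact this.good (hbranch c hc h1) (good_nil G)
  obtain ⟨c1, c2, hdeg⟩ := hdeg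
  by_cases k1 : c1 ∈ W ∧ G.Adj r c1
  · by_cases k2 : c2 ∈ W ∧ G.Adj r c2
    · by_cases k3 : c1 = c2
      · subst k3
        exact one c1 k1.1 k1.2 (fun x hx hrx => (hdeg x hx hrx).elim id id)
      · have hW : W = insert r (comp c1 ∪ comp c2) := by
          ext x
          simp only [Finset.mem_insert, Finset.mem_union]
          constructor
          · intro hx
            rcases hcov x (hconn x hx) with q | ⟨d, hd, hrd, hxd⟩
            · exact Or.inl q
            · rcases hdeg d hd hrd with rfl | rfl
              · exact Or.inr (Or.inl hxd)
              · exact Or.inr (Or.inr hxd)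
          · rintro (rfl | q | q)
            · exact hr
            · exact hsubW _ q
            · exact hsubW _ q
        have : NodeHyp G r (comp c1) {c1} (comp c2) {c2} :=
          ⟨hrc c1, hrc c2, hd c1 k1.1 k1.2 c2 k2.1 k2.2 k3, by simpa using hself c1 k1.1 k1.2,
            by simpa using hself c2 k2.1 k2.2, by simp, by simp, he c1 k1.1 k1.2 c2 k2.1 k2.2 k3,
            hadj c1 k1.1 k1.2, hadj c2 k2.1 k2.2⟩
        rw [hW]
        exact this.good (hbranch c1 k1.1 k1.2) (hbranch c2 k2.1 k2.2)
    · refine one c1 k1.1 k1.2 (fun x hx hrx => (hdeg x hx hrx).elim id ?_)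
      rintro rfl
      exact absurd ⟨hx, hrx⟩ k2
  · by_cases k2 : c2 ∈ W ∧ G.Adj r c2
    · refine one c2 k2.1 k2.2 (fun x hx hrx => (hdeg x hx hrx).elim ?_ id)
      rintro rfl
      exact absurd ⟨hx, hrx⟩ k1
    · have hno : ∀ x ∈ W, ¬ G.Adj r x := by
        intro x hx hrx
        rcases hdeg x hx hrx with rfl | rfl
        · exact k1 ⟨hx, hrx⟩
        · exact k2 ⟨hx, hrx⟩
      have hW : W = insert r (∅ ∪ ∅) := by
        ext x
        simp only [Finset.mem_insert, Finset.union_empty, Finset.notMem_empty, or_false]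
        constructor
        · intro hx
          rcases hcov x (hconn x hx) with q | ⟨d, hd, hrd, hxd⟩
          · exact q
          · exact absurd hrd (hno d hd)
        · rintro rfl
          exact hr
      have : NodeHyp G r ∅ ∅ ∅ ∅ := by constructor <;> simp
      rw [hW]
      exact this.good (good_nil G) (good_nil G)

lemma good_univ {V : Type*} [Fintype V] [DecidableEq V] {G : SimpleGraph V} (hG : G.IsTree)
    (hsub : Subcubic G) : ∃ r, Good G Finset.univ {r} := by
  classical
  have hex : ∃ r c, ∀ x, G.Adj r x → x = c := by
    rcases subsingleton_or_nontrivial V with h | h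
    · obtain ⟨r⟩ := hG.1.nonempty
      exact ⟨r, r, fun x _ => Subsingleton.elim _ _⟩
    · obtain ⟨r, hr⟩ := hG.exists_vert_degree_one_of_nontrivial
      rw [SimpleGraph.degree_eq_one_iff_existsUnique_adj] at hr
      obtain ⟨c, -, hc⟩ := hr
      exact ⟨r, c, fun x hx => hc x hx⟩
  obtain ⟨r, c, hc⟩ := hex
  refine ⟨r, good_of_tree hG.2 hsub _ r (Finset.mem_univ _) ?_ ⟨c, c, fun x _ hx => Or.inl (hc x hx)⟩⟩
  intro x _
  have := hG.1.preconnected r x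
  rw [SimpleGraph.reachable_iff_reflTransGen] at this
  exact Relation.ReflTransGen.mono (fun a b h => ⟨h, Finset.mem_univ _⟩) _ _ this

/-- If `T` is a subcubic tree with dissociation number `ψ`, then the number of maximum
dissociation sets of `T` is at most `1.466 ^ (ψ+2)`. -/
theorem numMaxDissoc_le_pow_dissocNum {V : Type*} [Fintype V] (T : SimpleGraph V)
    (hT : T.IsTree) (hsub : Subcubic T) :
    (numMaxDissoc T : ℝ) ≤ (1.466 : ℝ) ^ (dissocNum T + 2) := by
  classical
  obtain ⟨r, a, b, F, o, s, ⟨p, hA, -, -⟩, hK⟩ := good_univ hT hsub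
  have hF : 0 < F ∧ F ≤ 1.3961 := by
    rcases hK with ⟨-, -, x⟩ | ⟨-, -, x⟩ | ⟨-, -, x⟩ | ⟨-, -, x⟩
    · have := x.f; have := x.h1; constructor <;> linarith
    · have := x.f; have := x.h3; constructor <;> linarith
    · have := x.f; have := x.h5; constructor <;> linarith
    · have := x.f; have := x.h2; constructor <;> linarith
  obtain ⟨hub, hcnt⟩ := hA
  have hpos : 0 < ((famA T Finset.univ).filter (fun F => (F.card : ℤ) = p)).card := by
    have : (0 : ℝ) < F * (1.466 : ℝ) ^ p := mul_pos hF.1 (by positivity)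
    rw [← hcnt] at this
    exact_mod_cast this
  obtain ⟨F0, hF0⟩ := Finset.card_pos.1 hpos
  rw [Finset.mem_filter, mem_famA] at hF0
  obtain ⟨⟨-, hd0⟩, hc0⟩ := hF0
  have hnum : dissocNum T = F0.card := by
    unfold dissocNum
    apply IsGreatest.csSup_eq
    refine ⟨⟨F0, hd0, rfl⟩, ?_⟩
    rintro n ⟨F', h1, rfl⟩
    have := hub F' (mem_famA.2 ⟨Finset.subset_univ _, h1⟩)
    omega
  have hp : p = ((dissocNum T : ℕ) : ℤ) := by rw [hnum, hc0]
  have hN : numMaxDissoc T = ((famA T Finset.univ).filter (fun F => (F.card : ℤ) = p)).card := by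
    unfold numMaxDissoc
    rw [← Set.ncard_coe_finset]
    congr 1
    ext F'
    simp only [Set.mem_ofPred_eq, IsMaxDissocSet, Finset.coe_filter, mem_famA, hp,
      Finset.subset_univ, true_and, Nat.cast_inj]
  rw [hN, hcnt, hp, zpow_natCast, pow_add, mul_comm]
  apply mul_le_mul_of_nonneg_left _ (by positivity)
  have := hF.2
  norm_num at this ⊢
  linarith
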